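/- Let A be a set, B ⊆ A, n ≥ 1, and t : A^n → A an idempotent operation such that for every coordinate position j ∈ {1,...,n}, if all arguments except possibly the j-th lie in B, then the value of t lies in B (t is an absorption term witnessing B ⊴ A). Define d_0(x,y,z) = x, d_{n+1}(x,y,z) = z, and for 1 ≤ i ≤ n define d_i(x,y,z) = t(z, ..., z, y, x, ..., x) where z occupies the first i−1 coordinates and x the last n−i coordinates. Then: (a) d_i(x,y,y) = d_{i+1}(x,x,y) for all 0 ≤ i ≤ n and all x,y ∈ A; (b) each d_i satisfies d_i(B, A, B) ⊆ B, i.e., if x, z ∈ B and y ∈ A then d_i(x,y,z) ∈ B. (Hence an n-ary absorption term yields a Jónsson absorption chain of length n+2.) -/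

import Mathlib

theorem stmt7 {A : Type*} (B : Set A) (n : ℕ) (hn : 1 ≤ n)
    (t : (Fin n → A) → A)
    (hidem : ∀ x : A, t (fun _ => x) = x)
    (habs : ∀ (j : Fin n) (x : Fin n → A), (∀ i, i ≠ j → x i ∈ B) → t x ∈ B)
    (d : ℕ → A → A → A → A)
    (hd0 : ∀ x y z : A, d 0 x y z = x)
    (hdlast : ∀ x y z : A, d (n + 1) x y z = z)
    (hdi : ∀ i, 1 ≤ i → i ≤ n → ∀ x y z : A,
      d i x y z = t (fun j : Fin n =>
        if (j : ℕ) + 1 < i then z else if (j : ℕ) + 1 = i then y else x)) :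
    (∀ i ≤ n, ∀ x y : A, d i x y y = d (i + 1) x x y) ∧
    (∀ i ≤ n + 1, ∀ x y z : A, x ∈ B → z ∈ B → d i x y z ∈ B) := by
  refine ⟨fun i hi x y => ?_, fun i hi x y z hx hz => ?_⟩
  · rcases Nat.eq_zero_or_pos i with rfl | hpos
    · rw [hd0, hdi _ le_rfl hn]
      conv_lhs => rw [← hidem x]
      congr 1
      funext j
      grind
    · rw [hdi i hpos hi]
      rcases hi.eq_or_lt with rfl | hlt
      · rw [hdlast]
        conv_rhs => rw [← hidem y]
        congr 1
        funext j
        grind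
      · rw [hdi _ (by omega) hlt]
        congr 1
        funext j
        grind
  · rcases Nat.eq_zero_or_pos i with rfl | hpos
    · rwa [hd0]
    · rcases hi.eq_or_lt with rfl | hlt
      · rwa [hdlast]
      · rw [hdi i hpos (by omega)]
        refine habs ⟨i - 1, by omega⟩ _ fun j hj => ?_
        have hne : (j : ℕ) + 1 ≠ i := fun h => hj (Fin.ext (by simp [← h]))
        grind
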